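/- arXiv:2102.04828 — 3 statements merged into one kernel-verified Lean document; each statement's English description precedes it below -/
import Mathlib

section
/- Let n ≥ 1, p ∈ (0,1], and let W be a symmetric mixing matrix with parameter p. Then for every d ≥ 1 and every matrix X ∈ ℝ^{d×n}, the consensus distance is controlled by the locally computable quantity: ‖X − X̄‖_F ≤ (2/p)·‖XW − X‖_F. -/
open scoped BigOperators

/-- Frobenius norm of a real matrix. -/
noncomputable def frob {d n : ℕ} (X : Matrix (Fin d) (Fin n) ℝ) : ℝ :=
  Real.sqrt (∑ i, ∑ j, (X i j) ^ 2)

/-- The matrix `X̄` all of whose columns equal the column-wise mean `x̄ = (1/n) ∑ᵢ xᵢ` of `X`. -/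
noncomputable def colMeanMat {d n : ℕ} (X : Matrix (Fin d) (Fin n) ℝ) :
    Matrix (Fin d) (Fin n) ℝ :=
  Matrix.of fun i _ => (1 / (n : ℝ)) * ∑ j, X i j

/-- A doubly stochastic matrix: nonnegative entries with all row sums and column sums one. -/
def DoublyStochastic {n : ℕ} (W : Matrix (Fin n) (Fin n) ℝ) : Prop :=
  (∀ i j, 0 ≤ W i j) ∧ (∀ i, ∑ j, W i j = 1) ∧ (∀ j, ∑ i, W i j = 1)

/-- `W` is a mixing matrix with parameter `p`: it is doubly stochastic and
`‖XW − X̄‖_F² ≤ (1−p)·‖X − X̄‖_F²` for every `d` and `X ∈ ℝ^{d×n}`. -/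
def IsMixing {n : ℕ} (W : Matrix (Fin n) (Fin n) ℝ) (p : ℝ) : Prop :=
  DoublyStochastic W ∧ ∀ (d : ℕ) (X : Matrix (Fin d) (Fin n) ℝ),
    (frob (X * W - colMeanMat X)) ^ 2 ≤ (1 - p) * (frob (X - colMeanMat X)) ^ 2

open scoped Matrix.Norms.Frobenius in
lemma frob_eq_norm {d n : ℕ} (X : Matrix (Fin d) (Fin n) ℝ) : frob X = ‖X‖ := by
  simp [frob, Matrix.frobenius_norm_def, Real.sqrt_eq_rpow]

lemma frob_nonneg {d n : ℕ} (X : Matrix (Fin d) (Fin n) ℝ) : 0 ≤ frob X :=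
  Real.sqrt_nonneg _

open scoped Matrix.Norms.Frobenius in
lemma frob_sub_le_frob_sub_add_frob_sub {d n : ℕ} (X Y Z : Matrix (Fin d) (Fin n) ℝ) :
    frob (X - Z) ≤ frob (Y - X) + frob (Y - Z) := by
  simp only [frob_eq_norm]
  rw [norm_sub_rev Y X]
  exact norm_sub_le_norm_sub_add_norm_sub X Y Z

/-- For a symmetric mixing matrix `W` with parameter `p ∈ (0,1]`, the
consensus distance is controlled by the locally computable quantity:
`‖X − X̄‖_F ≤ (2/p)·‖XW − X‖_F`. -/
theorem consensus_distance_le_local_estimate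
    {n : ℕ} (hn : 1 ≤ n) (p : ℝ) (hp : 0 < p) (hp1 : p ≤ 1)
    (W : Matrix (Fin n) (Fin n) ℝ) (hWsymm : W.IsSymm) (hW : IsMixing W p) :
    ∀ (d : ℕ), 1 ≤ d → ∀ X : Matrix (Fin d) (Fin n) ℝ,
      frob (X - colMeanMat X) ≤ (2 / p) * frob (X * W - X) := by
  intro d _ X
  have htri := frob_sub_le_frob_sub_add_frob_sub X (X * W) (colMeanMat X)
  have hcontr : frob (X * W - colMeanMat X) ≤ (1 - p / 2) * frob (X - colMeanMat X) := by
    refine (pow_le_pow_iff_left₀ (frob_nonneg _)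
      (mul_nonneg (by linarith) (frob_nonneg _)) two_ne_zero).mp ?_
    calc frob (X * W - colMeanMat X) ^ 2
        ≤ (1 - p) * frob (X - colMeanMat X) ^ 2 := hW.2 d X
      _ ≤ (1 - p / 2) ^ 2 * frob (X - colMeanMat X) ^ 2 := by
          gcongr
          nlinarith [sq_nonneg p]
      _ = ((1 - p / 2) * frob (X - colMeanMat X)) ^ 2 := by ring
  rw [div_mul_eq_mul_div, le_div_iff₀ hp]
  linarith
end

section
/- Let n ≥ 1, p ∈ (0,1], and let W be a symmetric mixing matrix with parameter p. Then every eigenvalue μ of the symmetric matrix W − (1/n)𝟙𝟙ᵀ − I satisfies |μ| ≥ p/2. -/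
open scoped BigOperators

theorem frob_sq {d n : ℕ} (X : Matrix (Fin d) (Fin n) ℝ) :
    frob X ^ 2 = ∑ i, ∑ j, X i j ^ 2 :=
  Real.sq_sqrt (by positivity)

/-- For a symmetric mixing matrix `W` with parameter `p ∈ (0,1]`, every
eigenvalue `μ` of the symmetric matrix `W − (1/n)𝟙𝟙ᵀ − I` satisfies `|μ| ≥ p/2`. -/
theorem abs_eigenvalue_shifted_ge_half_p
    {n : ℕ} (hn : 1 ≤ n) (p : ℝ) (hp : 0 < p) (hp1 : p ≤ 1)
    (W : Matrix (Fin n) (Fin n) ℝ) (hWsymm : W.IsSymm) (hW : IsMixing W p)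
    (mu : ℝ) (v : Fin n → ℝ) (hv : v ≠ 0)
    (heig : (W - Matrix.of (fun _ _ : Fin n => (1 : ℝ) / n) - 1).mulVec v = mu • v) :
    p / 2 ≤ |mu| := by
  obtain ⟨⟨-, -, hcol⟩, hmix⟩ := hW
  have hn0 : (n : ℝ) ≠ 0 := by positivity
  have hWv : ∀ i, ∑ j, W i j * v j = (∑ j, v j) / n + (1 + mu) * v i := by
    intro i
    have h := congrFun heig i
    rw [Matrix.sub_mulVec, Matrix.sub_mulVec, Matrix.one_mulVec] at h
    simp only [Pi.sub_apply, Pi.smul_apply, smul_eq_mul, Matrix.mulVec, dotProduct,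
      Matrix.of_apply, ← Finset.mul_sum] at h
    linear_combination h
  have hsum : (1 + mu) * ∑ j, v j = 0 := by
    have h : ∑ i, ∑ j, W i j * v j = ∑ j, v j := by
      rw [Finset.sum_comm]
      simp [← Finset.sum_mul, hcol]
    simp only [hWv, Finset.sum_add_distrib, ← Finset.mul_sum, Finset.sum_const,
      Finset.card_univ, Fintype.card_fin, nsmul_eq_mul] at h
    rw [mul_div_cancel₀ _ hn0] at h
    linarith
  rcases mul_eq_zero.mp hsum with hmu | hs
  · rw [show mu = -1 by linarith, abs_neg, abs_one]
    linarith
  have hpos : 0 < ∑ j, v j ^ 2 := by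
    obtain ⟨k, hk⟩ := Function.ne_iff.mp hv
    exact Finset.sum_pos' (fun j _ => sq_nonneg _) ⟨k, Finset.mem_univ k, sq_pos_of_ne_zero hk⟩
  have hvW : ∀ j, ∑ k, v k * W k j = (1 + mu) * v j := by
    intro j
    have h := hWv j
    rw [hs, zero_div, zero_add] at h
    rw [← h]
    exact Finset.sum_congr rfl fun k _ => by rw [hWsymm.apply j k, mul_comm]
  have h := hmix 1 (Matrix.of fun _ j => v j)
  simp only [frob_sq, Matrix.sub_apply, Matrix.mul_apply, colMeanMat, Matrix.of_apply, hvW, hs,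
    mul_zero, sub_zero, Finset.univ_unique, Finset.sum_const, Finset.card_singleton, one_smul,
    mul_pow, ← Finset.mul_sum] at h
  have hle : (1 + mu) ^ 2 ≤ 1 - p := le_of_mul_le_mul_right h hpos
  by_contra! hlt
  obtain ⟨hlo, -⟩ := abs_lt.mp hlt
  nlinarith
end

section
/- (Typical consensus distance under slowly varying gradients.) Let p ∈ (0,1], γ ≥ 0, σ ≥ 0, and let (ξ_t)_{t≥0} and (φ_t)_{t≥0} be sequences of nonnegative reals such that ξ_0 = 0, ξ_{t+1} ≤ (1 − p/2)·ξ_t + (3(1−p)γ²/p)·(φ_t² + pσ²) for all t ≥ 0, and φ_t² ≤ (1 + p/4)·φ_{t+1}² for all t ≥ 0. Then for every t ≥ 1, ξ_t ≤ 12(1−p)γ²·(φ_{t−1}²/p² + σ²/p). -/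
/-- typical consensus distance under slowly varying gradients.
If `ξ₀ = 0`, `ξ_{t+1} ≤ (1 − p/2)ξ_t + (3(1−p)γ²/p)(φ_t² + pσ²)` and
`φ_t² ≤ (1 + p/4)φ_{t+1}²` for all `t`, then for every `t ≥ 1`,
`ξ_t ≤ 12(1−p)γ²(φ_{t−1}²/p² + σ²/p)`. -/
theorem typical_consensus_distance_slowly_varying
    (p γ σ : ℝ) (hp : 0 < p) (hp1 : p ≤ 1) (hγ : 0 ≤ γ) (hσ : 0 ≤ σ)
    (ξ φ : ℕ → ℝ) (hξnn : ∀ t, 0 ≤ ξ t) (hφnn : ∀ t, 0 ≤ φ t) (hξ0 : ξ 0 = 0)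
    (hrec : ∀ t, ξ (t + 1) ≤ (1 - p / 2) * ξ t
      + (3 * (1 - p) * γ ^ 2 / p) * ((φ t) ^ 2 + p * σ ^ 2))
    (hslow : ∀ t, (φ t) ^ 2 ≤ (1 + p / 4) * (φ (t + 1)) ^ 2) :
    ∀ t : ℕ, 1 ≤ t →
      ξ t ≤ 12 * (1 - p) * γ ^ 2 * ((φ (t - 1)) ^ 2 / p ^ 2 + σ ^ 2 / p) := by
  obtain ⟨K, hK⟩ : ∃ K, K = 3 * (1 - p) * γ ^ 2 / p ^ 2 := ⟨_, rfl⟩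
  have hK0 : 0 ≤ K := by
    have : 0 ≤ 1 - p := by linarith
    rw [hK]
    positivity
  have hcoef : 3 * (1 - p) * γ ^ 2 / p = K * p := by
    rw [hK]
    field_simp
  have key : ∀ t, ξ (t + 1) ≤ 4 * K * ((φ t) ^ 2 + p * σ ^ 2) := by
    intro t
    induction t with
    | zero =>
      have h := hrec 0
      rw [hξ0, hcoef] at h
      have h1 : 0 ≤ K * ((φ 0) ^ 2 + p * σ ^ 2) := by positivity
      nlinarith [mul_nonneg h1 (by linarith : 0 ≤ 4 - p)]
    | succ t ih =>
      have h := hrec (t + 1)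
      rw [hcoef] at h
      have hcontr : 0 ≤ 1 - p / 2 := by linarith
      calc ξ (t + 1 + 1)
          ≤ (1 - p / 2) * ξ (t + 1) + K * p * ((φ (t + 1)) ^ 2 + p * σ ^ 2) := h
        _ ≤ (1 - p / 2) * (4 * K * ((1 + p / 4) * (φ (t + 1)) ^ 2 + p * σ ^ 2))
            + K * p * ((φ (t + 1)) ^ 2 + p * σ ^ 2) := by
          gcongr
          refine ih.trans ?_
          gcongr
          exact hslow t
        _ = 4 * K * ((φ (t + 1)) ^ 2 + p * σ ^ 2)
            - K * p ^ 2 * ((φ (t + 1)) ^ 2 / 2 + σ ^ 2) := by ring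
        _ ≤ 4 * K * ((φ (t + 1)) ^ 2 + p * σ ^ 2) := sub_le_self _ (by positivity)
  rintro (_ | t) ht
  · omega
  · refine (key t).trans_eq ?_
    rw [hK, Nat.add_sub_cancel]
    field_simp
    ring
end
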